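/- For every positive integer n, in ℤ[q] one has ∑_{τ ∈ S_n} q^{exc(τ)} (−1)^{cyc(τ)} = −(q − 1)^{n−1}. -/

import Mathlib

open Finset Polynomial

/-- Number of excedances of a permutation: #{i : τ(i) > i}. -/
def exc {n : ℕ} (τ : Equiv.Perm (Fin n)) : ℕ :=
  (Finset.univ.filter fun i => i < τ i).card

/-- Number of cycles of a permutation, counting fixed points as cycles. -/
def cyc {n : ℕ} (τ : Equiv.Perm (Fin n)) : ℕ :=
  Multiset.card τ.cycleType + (Finset.univ.filter fun i => τ i = i).card

/-- Color sum of a colored permutation. -/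
def csum {r n : ℕ} (z : Fin n → Fin r) : ℕ := ∑ i, (z i : ℕ)

/-- #{i : z_i = 0 and τ(i) > i}. -/
def excA {r n : ℕ} (z : Fin n → Fin r) (τ : Equiv.Perm (Fin n)) : ℕ :=
  (Finset.univ.filter fun i => (z i : ℕ) = 0 ∧ i < τ i).card

/-- Excedance number with respect to the absolute order. -/
def excAbs {r n : ℕ} (z : Fin n → Fin r) (τ : Equiv.Perm (Fin n)) : ℕ :=
  exc τ + csum z

/-- Excedance number with respect to the color order. -/
def excClr {r n : ℕ} (z : Fin n → Fin r) (τ : Equiv.Perm (Fin n)) : ℕ :=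
  r * excA z τ + csum z

open Equiv in
theorem neg_one_pow_cyc {R : Type*} [CommRing R] {n : ℕ} (τ : Perm (Fin n)) :
    (-1 : R) ^ cyc τ = (-1) ^ n * ((Perm.sign τ : ℤ) : R) := by
  have hn : #{i | τ i = i} + #τ.support = n := by
    have h := card_filter_add_card_filter_not (s := (univ : Finset (Fin n))) (fun i => τ i = i)
    rw [card_univ, Fintype.card_fin] at h
    exact h
  rw [Perm.sign_of_cycleType, Perm.sum_cycleType, cyc]
  push_cast
  rw [← pow_add]
  exact neg_one_pow_congr (by grind)

/-- The square matrix with entries `x` strictly below the diagonal and `1` elsewhere. -/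
def excMatrix {R : Type*} [One R] (n : ℕ) (x : R) : Matrix (Fin n) (Fin n) R :=
  Matrix.of fun i j => if j < i then x else 1

theorem prod_excMatrix {R : Type*} [CommRing R] {n : ℕ} (x : R) (τ : Equiv.Perm (Fin n)) :
    ∏ i, excMatrix n x (τ i) i = x ^ exc τ := by
  simp [excMatrix, exc, prod_ite]

theorem det_excMatrix_succ {R : Type*} [CommRing R] (n : ℕ) (x : R) :
    (excMatrix (n + 1) x).det = (1 - x) ^ n := by
  let B : Matrix (Fin (n + 1)) (Fin (n + 1)) R :=
    Matrix.of fun i => Fin.cons (excMatrix (n + 1) x i 0)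
      fun j => if i = j.succ then 1 - x else 0
  have hdet : (excMatrix (n + 1) x).det = B.det := by
    refine Matrix.det_eq_of_forall_col_eq_smul_add_pred (fun _ => 1) (fun i => by simp [B])
      fun i j => ?_
    simp only [B, excMatrix, Matrix.of_apply, Fin.cons_succ, one_mul, Fin.lt_def, Fin.ext_iff,
      Fin.val_succ, Fin.val_castSucc]
    grind
  have hB : B.IsLowerTriangular := by
    intro i j hij
    have hij : i < j := hij
    cases j using Fin.cases with
    | zero => exact absurd hij (Fin.not_lt_zero i)
    | succ j => simp [B, hij.ne]
  rw [hdet, Matrix.det_of_isLowerTriangular B hB, Fin.prod_univ_succ]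
  simp [B, excMatrix]

theorem stmt12 (n : ℕ) (hn : 0 < n) :
    ∑ τ : Equiv.Perm (Fin n), (X : Polynomial ℤ) ^ exc τ * (-1) ^ cyc τ =
    -((X : Polynomial ℤ) - 1) ^ (n - 1) := by
  obtain ⟨m, rfl⟩ := Nat.exists_eq_add_one.mpr hn
  calc _ = (-1) ^ (m + 1) * (excMatrix (m + 1) (X : Polynomial ℤ)).det := by
        rw [Matrix.det_apply', mul_sum]
        refine sum_congr rfl fun τ _ => ?_
        rw [neg_one_pow_cyc, prod_excMatrix]
        ring
    _ = _ := by
        rw [det_excMatrix_succ, pow_succ, mul_right_comm, ← mul_pow]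
        simp
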